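/- arXiv:2411.04166 — 5 statements merged into one kernel-verified Lean document; each statement's English description precedes it below -/
import Mathlib

section
/- Let d ≥ 1 and h > 0, and set m_h := max(−1, 1−h²). Then ω_{d−1} ∫_{−1}^1 (1−(1−t)/h²)·1{(1−t)/h² ≤ 1}·(1−t²)^{d/2−1} dt = ω_d (1−h^{−2})[1 − F_d(m_h)] + ω_{d−1}(1−m_h²)^{d/2}/(d h²). In particular, if h ≥ √2 the right-hand side equals ω_d(1−h^{−2}); for d = 1 it equals 2h^{−2}[(h²−1)·arccos(m_h) + (1−m_h²)^{1/2}]; and for d = 2 it equals π(1−m_h)(2 − h^{−2}(1−m_h)). -/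
/-!
Proposition 1: normalizing constant of the Epanechnikov kernel on `S^d`.
-/

noncomputable section

/-- Surface area `ω_m = 2 π^{(m+1)/2} / Γ((m+1)/2)` of `S^m` (real parameter `m`). -/
def sphereArea (m : ℝ) : ℝ := 2 * Real.pi ^ ((m + 1) / 2) / Real.Gamma ((m + 1) / 2)

/-- The cdf `F_d` of `γ'X` for `X ∼ Unif(S^d)`:
`F_d(x) = (ω_{d-1}/ω_d) ∫_{-1}^x (1-t²)^{d/2-1} dt`. -/
def projUnifCDF (d : ℕ) (x : ℝ) : ℝ :=
  sphereArea ((d : ℝ) - 1) / sphereArea (d : ℝ) *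
    ∫ t in (-1 : ℝ)..x, (1 - t ^ 2) ^ ((d : ℝ) / 2 - 1)

lemma one_sub_sq_pos {t : ℝ} (ht : t ∈ Set.Ioo (-1 : ℝ) 1) : 0 < 1 - t ^ 2 := by
  nlinarith [ht.1, ht.2]

lemma one_sub_sq_rpow_neg_half {t : ℝ} (ht : t ∈ Set.Ioo (-1 : ℝ) 1) :
    (1 - t ^ 2) ^ ((1 : ℝ) / 2 - 1) = 1 / Real.sqrt (1 - t ^ 2) := by
  rw [Real.sqrt_eq_rpow, one_div ((1 - t ^ 2) ^ _), ← Real.rpow_neg (one_sub_sq_pos ht).le]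
  norm_num

lemma hasDerivAt_arcsin_rpow {t : ℝ} (ht : t ∈ Set.Ioo (-1 : ℝ) 1) :
    HasDerivAt Real.arcsin ((1 - t ^ 2) ^ ((1 : ℝ) / 2 - 1)) t := by
  rw [one_sub_sq_rpow_neg_half ht]
  exact Real.hasDerivAt_arcsin ht.1.ne' ht.2.ne

lemma hasDerivAt_one_sub_sq_rpow (p : ℝ) {t : ℝ} (ht : t ∈ Set.Ioo (-1 : ℝ) 1) :
    HasDerivAt (fun t : ℝ ↦ (1 - t ^ 2) ^ p) (-2 * t * p * (1 - t ^ 2) ^ (p - 1)) t := by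
  have h1 : HasDerivAt (fun t : ℝ ↦ 1 - t ^ 2) (-2 * t) t :=
    ((hasDerivAt_pow 2 t).const_sub 1).congr_deriv (by norm_num)
  exact h1.rpow_const (Or.inl (one_sub_sq_pos ht).ne')

lemma continuous_one_sub_sq_rpow {p : ℝ} (hp : 0 ≤ p) :
    Continuous fun t : ℝ ↦ (1 - t ^ 2) ^ p :=
  (by fun_prop : Continuous fun t : ℝ ↦ 1 - t ^ 2).rpow_const fun _ ↦ Or.inr hp

lemma intervalIntegrable_one_sub_sq_rpow {d : ℕ} (hd : 1 ≤ d) :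
    IntervalIntegrable (fun t : ℝ ↦ (1 - t ^ 2) ^ ((d : ℝ) / 2 - 1)) MeasureTheory.volume
      (-1) 1 := by
  obtain rfl | hd2 := hd.eq_or_lt
  · refine intervalIntegral.intervalIntegrable_deriv_of_nonneg (g := Real.arcsin)
      Real.continuous_arcsin.continuousOn ?_ ?_
    · intro t ht
      rw [min_eq_left (by norm_num), max_eq_right (by norm_num)] at ht
      simpa using hasDerivAt_arcsin_rpow ht
    · intro t ht
      rw [min_eq_left (by norm_num), max_eq_right (by norm_num)] at ht
      exact Real.rpow_nonneg (one_sub_sq_pos ht).le _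
  · have : (2 : ℝ) ≤ d := by exact_mod_cast hd2
    exact (continuous_one_sub_sq_rpow (by linarith)).intervalIntegrable _ _

lemma intervalIntegrable_one_sub_sq_rpow_of_mem {d : ℕ} (hd : 1 ≤ d) {a b : ℝ}
    (ha : a ∈ Set.Icc (-1 : ℝ) 1) (hb : b ∈ Set.Icc (-1 : ℝ) 1) :
    IntervalIntegrable (fun t : ℝ ↦ (1 - t ^ 2) ^ ((d : ℝ) / 2 - 1)) MeasureTheory.volume
      a b := by
  refine (intervalIntegrable_one_sub_sq_rpow hd).mono_set (Set.uIcc_subset_uIcc ?_ ?_) <;>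
  rwa [Set.uIcc_of_le (by norm_num)]

lemma integral_one_sub_sq_rpow_neg_half {m : ℝ} (hm : m ∈ Set.Icc (-1 : ℝ) 1) :
    ∫ t in m..1, (1 - t ^ 2) ^ ((1 : ℝ) / 2 - 1) = Real.arccos m := by
  rw [intervalIntegral.integral_eq_sub_of_hasDerivAt_of_le hm.2
    Real.continuous_arcsin.continuousOn
    (fun t ht ↦ hasDerivAt_arcsin_rpow ⟨hm.1.trans_lt ht.1, ht.2⟩)
    (by
      have := intervalIntegrable_one_sub_sq_rpow_of_mem le_rfl hm
        (Set.right_mem_Icc.2 (by norm_num))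
      rwa [Nat.cast_one] at this),
    Real.arcsin_one, Real.arccos]

lemma integral_mul_one_sub_sq_rpow {d : ℕ} (hd : 1 ≤ d) {m : ℝ} (hm : m ∈ Set.Icc (-1 : ℝ) 1) :
    ∫ t in m..1, t * (1 - t ^ 2) ^ ((d : ℝ) / 2 - 1) = (1 - m ^ 2) ^ ((d : ℝ) / 2) / d := by
  have hd0 : (0 : ℝ) < d := by exact_mod_cast hd
  rw [intervalIntegral.integral_eq_sub_of_hasDerivAt_of_le
    (f := fun t ↦ (1 - t ^ 2) ^ ((d : ℝ) / 2) * (-1 / d)) hm.2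
    ((continuous_one_sub_sq_rpow (by positivity)).mul_const _).continuousOn]
  · rw [one_pow, sub_self, Real.zero_rpow (by positivity)]
    ring
  · intro t ht
    refine ((hasDerivAt_one_sub_sq_rpow ((d : ℝ) / 2)
      ⟨hm.1.trans_lt ht.1, ht.2⟩).mul_const (-1 / (d : ℝ))).congr_deriv ?_
    field_simp
  · exact (intervalIntegrable_one_sub_sq_rpow_of_mem hd hm
      (Set.right_mem_Icc.2 (by norm_num))).continuousOn_mul continuousOn_id

lemma integral_one_sub_sq_rpow_succ {d : ℕ} (hd : 1 ≤ d) :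
    ((d : ℝ) + 1) * ∫ t in (-1 : ℝ)..1, (1 - t ^ 2) ^ ((d : ℝ) / 2) =
      d * ∫ t in (-1 : ℝ)..1, (1 - t ^ 2) ^ ((d : ℝ) / 2 - 1) := by
  have hd0 : (0 : ℝ) < d := by exact_mod_cast hd
  have hcont := continuous_one_sub_sq_rpow (p := (d : ℝ) / 2) (by positivity)
  have hi1 := (hcont.intervalIntegrable (μ := MeasureTheory.volume) (-1) 1).const_mul
    ((d : ℝ) + 1)
  have hi2 := (intervalIntegrable_one_sub_sq_rpow hd).const_mul (d : ℝ)
  rw [← sub_eq_zero, ← intervalIntegral.integral_const_mul, ← intervalIntegral.integral_const_mul,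
    ← intervalIntegral.integral_sub hi1 hi2,
    intervalIntegral.integral_eq_sub_of_hasDerivAt_of_le
      (f := fun t ↦ t * (1 - t ^ 2) ^ ((d : ℝ) / 2)) (by norm_num)
      (continuous_id.mul hcont).continuousOn ?_ (hi1.sub hi2)]
  · norm_num [Real.zero_rpow (show (d : ℝ) / 2 ≠ 0 by positivity)]
  · intro t ht
    refine ((hasDerivAt_id t).mul (hasDerivAt_one_sub_sq_rpow ((d : ℝ) / 2) ht)).congr_deriv ?_
    rw [Real.rpow_sub_one (one_sub_sq_pos ht).ne']
    have := (one_sub_sq_pos ht).ne'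
    simp only [id]
    field_simp
    ring

lemma sphereArea_pos {m : ℝ} (hm : -1 < m) : 0 < sphereArea m := by
  have := Real.Gamma_pos_of_pos (show 0 < (m + 1) / 2 by linarith)
  unfold sphereArea
  positivity

lemma sphereArea_add_two {m : ℝ} (hm : -1 < m) :
    sphereArea (m + 2) = 2 * Real.pi / (m + 1) * sphereArea m := by
  have h0 : (m + 1) / 2 ≠ 0 := by linarith
  have h1 := (Real.Gamma_pos_of_pos (show 0 < (m + 1) / 2 by linarith)).ne'
  have h2 : m + 1 ≠ 0 := by linarith
  unfold sphereArea
  rw [show (m + 2 + 1) / 2 = (m + 1) / 2 + 1 by ring, Real.Gamma_add_one h0,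
    Real.rpow_add_one Real.pi_pos.ne']
  field_simp

lemma sphereArea_zero : sphereArea 0 = 2 := by
  have := (Real.sqrt_pos.2 Real.pi_pos).ne'
  rw [sphereArea, zero_add, Real.Gamma_one_half_eq, ← Real.sqrt_eq_rpow]
  field_simp

lemma sphereArea_one : sphereArea 1 = 2 * Real.pi := by
  norm_num [sphereArea]

lemma sphereArea_two : sphereArea 2 = 4 * Real.pi := by
  have := sphereArea_add_two (m := 0) (by norm_num)
  rw [zero_add, sphereArea_zero] at this
  rw [this]
  ring

/-- The surface area of `S^d` obtained by slicing along a diameter. -/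
lemma sphereArea_mul_integral_one_sub_sq_rpow {d : ℕ} (hd : 1 ≤ d) :
    sphereArea ((d : ℝ) - 1) * ∫ t in (-1 : ℝ)..1, (1 - t ^ 2) ^ ((d : ℝ) / 2 - 1) =
      sphereArea d := by
  induction d using Nat.strong_induction_on with
  | _ d ih =>
    match d, hd with
    | 1, _ =>
      rw [Nat.cast_one, integral_one_sub_sq_rpow_neg_half (by norm_num), sub_self,
        sphereArea_zero, sphereArea_one, Real.arccos_neg_one]
    | 2, _ => norm_num [sphereArea_one, sphereArea_two]; ring
    | d + 3, _ =>
      have ih' := ih (d + 1) (by lia) (by lia)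
      have hrec := integral_one_sub_sq_rpow_succ (d := d + 1) (by lia)
      have hd0 : (0 : ℝ) ≤ d := d.cast_nonneg
      push_cast at ih' hrec ⊢
      rw [show ((d : ℝ) + 3) / 2 - 1 = (d + 1) / 2 by ring,
        show (d : ℝ) + 3 - 1 = (d + 1 - 1) + 2 by ring,
        show (d : ℝ) + 3 = (d + 1) + 2 by ring,
        sphereArea_add_two (by linarith), sphereArea_add_two (by linarith), ← ih']
      rw [add_sub_cancel_right]
      generalize (∫ t in (-1 : ℝ)..1, (1 - t ^ 2) ^ (((d : ℝ) + 1) / 2)) = I at *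
      generalize (∫ t in (-1 : ℝ)..1, (1 - t ^ 2) ^ (((d : ℝ) + 1) / 2 - 1)) = J at *
      field_simp
      linear_combination sphereArea (d : ℝ) * hrec

lemma sphereArea_mul_one_sub_projUnifCDF {d : ℕ} (hd : 1 ≤ d) {m : ℝ}
    (hm : m ∈ Set.Icc (-1 : ℝ) 1) :
    sphereArea d * (1 - projUnifCDF d m) =
      sphereArea ((d : ℝ) - 1) * ∫ t in m..1, (1 - t ^ 2) ^ ((d : ℝ) / 2 - 1) := by
  have hd0 : (0 : ℝ) < d := by exact_mod_cast hd
  have hne := (sphereArea_pos (show -1 < (d : ℝ) by linarith)).ne'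
  have hadd := intervalIntegral.integral_add_adjacent_intervals
    (intervalIntegrable_one_sub_sq_rpow_of_mem hd (Set.left_mem_Icc.2 (by norm_num)) hm)
    (intervalIntegrable_one_sub_sq_rpow_of_mem hd hm (Set.right_mem_Icc.2 (by norm_num)))
  have hcancel : sphereArea d * projUnifCDF d m = sphereArea ((d : ℝ) - 1) *
      ∫ t in (-1 : ℝ)..m, (1 - t ^ 2) ^ ((d : ℝ) / 2 - 1) := by
    unfold projUnifCDF
    field_simp
  rw [mul_sub, mul_one, hcancel, ← sphereArea_mul_integral_one_sub_sq_rpow hd, ← hadd]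
  ring

lemma integral_epanechnikov_mul_one_sub_sq_rpow {d : ℕ} (hd : 1 ≤ d) {h : ℝ} (hh : 0 < h)
    {m : ℝ} (hm : m = max (-1) (1 - h ^ 2)) :
    ∫ t in (-1 : ℝ)..1, (if (1 - t) / h ^ 2 ≤ 1 then 1 - (1 - t) / h ^ 2 else 0) *
        (1 - t ^ 2) ^ ((d : ℝ) / 2 - 1) =
      (1 - (h ^ 2)⁻¹) * (∫ t in m..1, (1 - t ^ 2) ^ ((d : ℝ) / 2 - 1)) +
        (h ^ 2)⁻¹ * ((1 - m ^ 2) ^ ((d : ℝ) / 2) / d) := by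
  have hh2 : 0 < h ^ 2 := by positivity
  have hmem : m ∈ Set.Icc (-1 : ℝ) 1 :=
    ⟨hm ▸ le_max_left _ _, hm ▸ max_le (by norm_num) (by linarith)⟩
  have hleft : Set.EqOn (fun _ ↦ (0 : ℝ)) (fun t : ℝ ↦
      (if (1 - t) / h ^ 2 ≤ 1 then 1 - (1 - t) / h ^ 2 else 0) *
        (1 - t ^ 2) ^ ((d : ℝ) / 2 - 1)) (Set.uIoo (-1) m) := by
    intro t ht
    rw [Set.uIoo_of_le hmem.1] at ht
    have : t < 1 - h ^ 2 := by
      have h2 := ht.2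
      rw [hm, lt_max_iff] at h2
      exact h2.resolve_left ht.1.not_gt
    simp only
    rw [if_neg (by rw [div_le_one hh2]; linarith), zero_mul]
  have hright : Set.EqOn (fun t : ℝ ↦ (1 - (h ^ 2)⁻¹) * (1 - t ^ 2) ^ ((d : ℝ) / 2 - 1) +
      (h ^ 2)⁻¹ * (t * (1 - t ^ 2) ^ ((d : ℝ) / 2 - 1))) (fun t : ℝ ↦
      (if (1 - t) / h ^ 2 ≤ 1 then 1 - (1 - t) / h ^ 2 else 0) *
        (1 - t ^ 2) ^ ((d : ℝ) / 2 - 1)) (Set.uIoo m 1) := by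
    intro t ht
    rw [Set.uIoo_of_le hmem.2] at ht
    have : 1 - h ^ 2 < t := (hm ▸ le_max_right _ _ : 1 - h ^ 2 ≤ m).trans_lt ht.1
    simp only
    rw [if_pos (by rw [div_le_one hh2]; linarith)]
    ring
  have hw := intervalIntegrable_one_sub_sq_rpow_of_mem hd hmem (Set.right_mem_Icc.2 (by norm_num))
  have hi1 := hw.const_mul (1 - (h ^ 2)⁻¹)
  have hi2 := (hw.continuousOn_mul (g := fun t ↦ t) continuousOn_id).const_mul (h ^ 2)⁻¹
  rw [← intervalIntegral.integral_add_adjacent_intervals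
      (intervalIntegrable_const.congr_uIoo hleft) ((hi1.add hi2).congr_uIoo hright),
    ← intervalIntegral.integral_congr_uIoo hleft, ← intervalIntegral.integral_congr_uIoo hright,
    intervalIntegral.integral_zero, zero_add, intervalIntegral.integral_add hi1 hi2,
    intervalIntegral.integral_const_mul, intervalIntegral.integral_const_mul]
  rw [integral_mul_one_sub_sq_rpow hd hmem]

theorem epanechnikov_normalizing_constant
    (d : ℕ) (hd : 1 ≤ d) (h : ℝ) (hh : 0 < h) (m : ℝ) (hm : m = max (-1) (1 - h ^ 2)) :
    sphereArea ((d : ℝ) - 1) *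
        ∫ t in (-1 : ℝ)..1,
          (if (1 - t) / h ^ 2 ≤ 1 then 1 - (1 - t) / h ^ 2 else 0) *
            (1 - t ^ 2) ^ ((d : ℝ) / 2 - 1)
      = sphereArea (d : ℝ) * (1 - (h ^ 2)⁻¹) * (1 - projUnifCDF d m) +
          sphereArea ((d : ℝ) - 1) * (1 - m ^ 2) ^ ((d : ℝ) / 2) / (d * h ^ 2) ∧
    (Real.sqrt 2 ≤ h →
      sphereArea (d : ℝ) * (1 - (h ^ 2)⁻¹) * (1 - projUnifCDF d m) +
          sphereArea ((d : ℝ) - 1) * (1 - m ^ 2) ^ ((d : ℝ) / 2) / (d * h ^ 2)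
        = sphereArea (d : ℝ) * (1 - (h ^ 2)⁻¹)) ∧
    (d = 1 →
      sphereArea (d : ℝ) * (1 - (h ^ 2)⁻¹) * (1 - projUnifCDF d m) +
          sphereArea ((d : ℝ) - 1) * (1 - m ^ 2) ^ ((d : ℝ) / 2) / (d * h ^ 2)
        = 2 * (h ^ 2)⁻¹ *
            ((h ^ 2 - 1) * Real.arccos m + Real.sqrt (1 - m ^ 2))) ∧
    (d = 2 →
      sphereArea (d : ℝ) * (1 - (h ^ 2)⁻¹) * (1 - projUnifCDF d m) +
          sphereArea ((d : ℝ) - 1) * (1 - m ^ 2) ^ ((d : ℝ) / 2) / (d * h ^ 2)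
        = Real.pi * (1 - m) * (2 - (h ^ 2)⁻¹ * (1 - m))) := by
  have hmem : m ∈ Set.Icc (-1 : ℝ) 1 :=
    ⟨hm ▸ le_max_left _ _, hm ▸ max_le (by norm_num) (by nlinarith)⟩
  have hd0 : (0 : ℝ) < d := by exact_mod_cast hd
  have hcdf := sphereArea_mul_one_sub_projUnifCDF hd hmem
  rw [mul_right_comm, hcdf]
  refine ⟨?_, fun hs ↦ ?_, ?_, ?_⟩
  · rw [integral_epanechnikov_mul_one_sub_sq_rpow hd hh hm]
    field_simp
  · have h2 : 2 ≤ h ^ 2 := (Real.sqrt_le_left hh.le).1 hs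
    have hm1 : m = -1 := by rw [hm, max_eq_left (by linarith)]
    rw [hm1, sphereArea_mul_integral_one_sub_sq_rpow hd, neg_one_sq, sub_self,
      Real.zero_rpow (by positivity)]
    ring
  · rintro rfl
    rw [Nat.cast_one, integral_one_sub_sq_rpow_neg_half hmem, sub_self, sphereArea_zero,
      ← Real.sqrt_eq_rpow]
    field_simp
  · rintro rfl
    norm_num [sphereArea_one]
    field_simp
    ring
end
end

section
/- Let h > 0, υ > 0, and define Li₂(−e^w) := −∫_0^∞ t/(e^{t−w}+1) dt for w ∈ ℝ (the dilogarithm at −e^w, via its integral representation). Then the reciprocal normalizing constant of the softplus kernel on S², c_{2,L_{sfp_υ}}(h)^{-1} := 2π ∫_{−1}^1 log(1+e^{υ(1−(1−t)h^{−2})})/log(1+e^υ) dt, equals (2π h² / (log(1+e^υ)·υ)) · [ Li₂(−e^{υ(1−2h^{−2})}) − Li₂(−e^υ) ]. Moreover, the angular cdf of T = Y'μ for Y drawn from the normalized softplus kernel on S² is F_{2,sfp_υ,h}(t) = [ Li₂(−e^{υ(1−2h^{−2})}) − Li₂(−e^{υ(1−(1−t)h^{−2})}) ] / [ Li₂(−e^{υ(1−2h^{−2})})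 − Li₂(−e^υ) ] for t ∈ [−1,1]. -/
/-!
Proposition 3: normalizing constant and angular cdf of the softplus kernel on `S²`.
-/

open MeasureTheory

noncomputable section

/-- The dilogarithm at `-e^w`, via its integral representation:
`Li₂(-e^w) = -∫_0^∞ t/(e^{t-w}+1) dt`. -/
def Li2negExp (w : ℝ) : ℝ := -∫ t in Set.Ioi (0 : ℝ), t / (Real.exp (t - w) + 1)

/-- The softplus function `sfp(t) = log(1+e^t)`. -/
def sfp (t : ℝ) : ℝ := Real.log (1 + Real.exp t)

/-- The softplus kernel `L_{sfp_υ}(t) = sfp(υ(1-t))/sfp(υ)`. -/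
def sfpKernel (u t : ℝ) : ℝ := sfp (u * (1 - t)) / sfp u

lemma one_add_exp_pos (x : ℝ) : 0 < 1 + Real.exp x := by positivity

lemma sfp_pos (x : ℝ) : 0 < sfp x :=
  Real.log_pos (by linarith [Real.exp_pos x])

lemma sfp_le_exp (x : ℝ) : sfp x ≤ Real.exp x := by
  have := Real.log_le_sub_one_of_pos (one_add_exp_pos x)
  unfold sfp
  linarith

lemma hasDerivAt_sfp (x : ℝ) : HasDerivAt sfp (1 / (Real.exp (-x) + 1)) x := by
  have h := ((Real.hasDerivAt_exp x).const_add 1).log (one_add_exp_pos x).ne'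
  have he : Real.exp x / (1 + Real.exp x) = 1 / (Real.exp (-x) + 1) := by
    rw [Real.exp_neg]
    field_simp
  exact he ▸ h

lemma continuous_sfp : Continuous sfp :=
  continuous_iff_continuousAt.2 fun x => (hasDerivAt_sfp x).continuousAt

lemma integrableOn_sfp_Iic (w : ℝ) : IntegrableOn sfp (Set.Iic w) := by
  refine (integrableOn_exp_Iic w).mono' continuous_sfp.aestronglyMeasurable ?_
  refine Filter.Eventually.of_forall fun x => ?_
  rw [Real.norm_of_nonneg (sfp_pos x).le]
  exact sfp_le_exp x

lemma integrableOn_sfp_sub_Ioi (w : ℝ) :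
    IntegrableOn (fun t => sfp (w - t)) (Set.Ioi 0) := by
  refine ((integrableOn_exp_neg_Ioi 0).const_mul (Real.exp w)).mono'
    (continuous_sfp.comp (continuous_const.sub continuous_id)).aestronglyMeasurable ?_
  refine Filter.Eventually.of_forall fun x => ?_
  rw [Real.norm_of_nonneg (sfp_pos _).le, ← Real.exp_add, ← sub_eq_add_neg]
  exact sfp_le_exp _

lemma integrableOn_mul_exp_neg_Ioi :
    IntegrableOn (fun t : ℝ => t * Real.exp (-t)) (Set.Ioi 0) := by
  have h := Real.GammaIntegral_convergent (s := 2) two_pos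
  refine h.congr_fun (fun t _ => ?_) measurableSet_Ioi
  norm_num [mul_comm]

lemma integrableOn_div_exp_sub_add_one_Ioi (w : ℝ) :
    IntegrableOn (fun t => t / (Real.exp (t - w) + 1)) (Set.Ioi 0) := by
  refine (integrableOn_mul_exp_neg_Ioi.const_mul (Real.exp w)).mono'
    (Measurable.aestronglyMeasurable (by fun_prop)) ?_
  refine (ae_restrict_iff' measurableSet_Ioi).2 (Filter.Eventually.of_forall fun t ht => ?_)
  have ht : 0 < t := ht
  rw [Real.norm_of_nonneg (by positivity), mul_left_comm, ← Real.exp_add, div_eq_mul_inv]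
  gcongr
  rw [show w + -t = -(t - w) by ring, Real.exp_neg]
  gcongr
  linarith

lemma tendsto_mul_sfp_sub_atTop (w : ℝ) :
    Filter.Tendsto (fun t => t * sfp (w - t)) Filter.atTop (nhds 0) := by
  have h := (Real.tendsto_pow_mul_exp_neg_atTop_nhds_zero 1).const_mul (Real.exp w)
  rw [mul_zero] at h
  refine tendsto_of_tendsto_of_tendsto_of_le_of_le' tendsto_const_nhds h ?_ ?_
  · filter_upwards [Filter.eventually_ge_atTop 0] with t ht
    exact mul_nonneg ht (sfp_pos _).le
  · filter_upwards [Filter.eventually_ge_atTop 0] with t ht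
    rw [pow_one, mul_left_comm, ← Real.exp_add, ← sub_eq_add_neg]
    exact mul_le_mul_of_nonneg_left (sfp_le_exp _) ht

lemma integral_div_exp_sub_add_one_eq (w : ℝ) :
    ∫ t in Set.Ioi (0 : ℝ), t / (Real.exp (t - w) + 1) =
      ∫ t in Set.Ioi (0 : ℝ), sfp (w - t) := by
  have hd (t : ℝ) : HasDerivAt (fun t => t * sfp (w - t))
      (sfp (w - t) - t / (Real.exp (t - w) + 1)) t := by
    refine ((hasDerivAt_id' t).mul
      ((hasDerivAt_sfp (w - t)).comp t ((hasDerivAt_id' t).const_sub w))).congr_deriv ?_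
    simp only [neg_sub, Function.comp]
    ring
  have h := integral_Ioi_of_hasDerivAt_of_tendsto' (a := 0) (fun t _ => hd t)
    ((integrableOn_sfp_sub_Ioi w).sub (integrableOn_div_exp_sub_add_one_Ioi w))
    (tendsto_mul_sfp_sub_atTop w)
  rw [integral_sub (integrableOn_sfp_sub_Ioi w) (integrableOn_div_exp_sub_add_one_Ioi w)] at h
  linarith

lemma Li2negExp_eq_neg_integral_sfp (w : ℝ) :
    Li2negExp w = -∫ x in Set.Iic w, sfp x := by
  have h := (Measure.measurePreserving_sub_left (volume : Measure ℝ) w).setIntegral_preimage_emb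
    (MeasurableEquiv.subLeft w).measurableEmbedding sfp (Set.Iio w)
  rw [Set.preimage_const_sub_Iio, sub_self] at h
  rw [Li2negExp, integral_div_exp_sub_add_one_eq, h, integral_Iic_eq_integral_Iio]

/-- The dilogarithm `w ↦ Li₂(-e^w)` is an antiderivative of `-sfp`. -/
lemma integral_sfp (a b : ℝ) : ∫ x in a..b, sfp x = Li2negExp a - Li2negExp b := by
  rw [← intervalIntegral.integral_Iic_sub_Iic (integrableOn_sfp_Iic a) (integrableOn_sfp_Iic b),
    Li2negExp_eq_neg_integral_sfp, Li2negExp_eq_neg_integral_sfp]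
  ring

lemma integral_sfpKernel {h u : ℝ} (hh : h ≠ 0) (hu : u ≠ 0) (t : ℝ) :
    ∫ s in (-1 : ℝ)..t, sfpKernel u ((1 - s) / h ^ 2) =
      h ^ 2 / (sfp u * u) *
        (Li2negExp (u * (1 - 2 / h ^ 2)) - Li2negExp (u * (1 - (1 - t) / h ^ 2))) := by
  have hs (s : ℝ) : sfpKernel u ((1 - s) / h ^ 2) =
      sfp (u / h ^ 2 * s + (u - u / h ^ 2)) / sfp u := by
    rw [sfpKernel]
    ring_nf
  simp_rw [hs]
  rw [intervalIntegral.integral_div, intervalIntegral.integral_comp_mul_add sfp (by positivity),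
    integral_sfp, smul_eq_mul, inv_div,
    show u / h ^ 2 * -1 + (u - u / h ^ 2) = u * (1 - 2 / h ^ 2) by ring,
    show u / h ^ 2 * t + (u - u / h ^ 2) = u * (1 - (1 - t) / h ^ 2) by ring]
  ring

theorem softplus_normalizing_constant_and_angular_cdf_sphere2
    (h u : ℝ) (hh : 0 < h) (hu : 0 < u) :
    (2 * Real.pi * ∫ t in (-1 : ℝ)..1, sfpKernel u ((1 - t) / h ^ 2))
      = 2 * Real.pi * h ^ 2 / (sfp u * u) *
          (Li2negExp (u * (1 - 2 / h ^ 2)) - Li2negExp u) ∧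
    ∀ t ∈ Set.Icc (-1 : ℝ) 1,
      (∫ s in (-1 : ℝ)..t, sfpKernel u ((1 - s) / h ^ 2)) /
          (∫ s in (-1 : ℝ)..1, sfpKernel u ((1 - s) / h ^ 2))
        = (Li2negExp (u * (1 - 2 / h ^ 2)) - Li2negExp (u * (1 - (1 - t) / h ^ 2))) /
            (Li2negExp (u * (1 - 2 / h ^ 2)) - Li2negExp u) := by
  have hI := integral_sfpKernel hh.ne' hu.ne'
  have h1 : u * (1 - (1 - 1) / h ^ 2) = u := by simp
  have hc : h ^ 2 / (sfp u * u) ≠ 0 := by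
    have := sfp_pos u
    positivity
  refine ⟨?_, fun t _ => ?_⟩
  · rw [hI 1, h1]
    ring
  · rw [hI t, hI 1, h1, mul_div_mul_left _ _ hc]
end
end

section
/- For every real a > −1 and υ > 0, ∫_0^∞ s^a log(1 + e^{υ(1−s)}) ds = (1/((a+1)·υ^{a+1})) · ∫_0^∞ u^{a+1}/(e^{u−υ}+1) du. Equivalently, with the polylogarithm at negative exponential arguments given by Li_{a+2}(−e^υ) := −(1/Γ(a+2)) ∫_0^∞ u^{a+1}/(e^{u−υ}+1) du, one has ∫_0^∞ s^a log(1 + e^{υ(1−s)}) ds = −(Γ(a+1)/υ^{a+1})·Li_{a+2}(−e^υ). -/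
/-!
Softplus moment identity:
`∫_0^∞ s^a log(1+e^{υ(1-s)}) ds = (1/((a+1)υ^{a+1})) ∫_0^∞ u^{a+1}/(e^{u-υ}+1) du
  = -(Γ(a+1)/υ^{a+1}) Li_{a+2}(-e^υ)`.
-/

open MeasureTheory

noncomputable section

/-- `Li_s(-e^w) = -Γ(s)⁻¹ ∫_0^∞ t^{s-1}/(e^{t-w}+1) dt`. -/
def LiNegExp (s w : ℝ) : ℝ :=
  -(Real.Gamma s)⁻¹ * ∫ t in Set.Ioi (0 : ℝ), t ^ (s - 1) / (Real.exp (t - w) + 1)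

theorem log_one_add_exp_sub_le (w t : ℝ) :
    Real.log (1 + Real.exp (w - t)) ≤ Real.exp w * Real.exp (-t) := by
  rw [← Real.exp_add, ← sub_eq_add_neg]
  have := Real.log_le_sub_one_of_pos (x := 1 + Real.exp (w - t)) (by positivity)
  linarith

theorem inv_exp_sub_add_one_le (w t : ℝ) :
    (Real.exp (t - w) + 1)⁻¹ ≤ Real.exp w * Real.exp (-t) := by
  rw [← Real.exp_add, ← sub_eq_add_neg, ← neg_sub t w, Real.exp_neg]
  gcongr
  linarith

theorem log_one_add_exp_nonneg (x : ℝ) : 0 ≤ Real.log (1 + Real.exp x) :=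
  Real.log_nonneg (by linarith [Real.exp_pos x])

theorem hasDerivAt_log_one_add_exp_sub (w t : ℝ) :
    HasDerivAt (fun t => Real.log (1 + Real.exp (w - t))) (-(Real.exp (t - w) + 1)⁻¹) t := by
  have h : HasDerivAt (fun t => Real.log (1 + Real.exp (w - t)))
      (Real.exp (w - t) * (-1) / (1 + Real.exp (w - t))) t :=
    (((hasDerivAt_id t).const_sub w).exp.const_add 1).log (by positivity)
  convert h using 1
  rw [← neg_sub w t, Real.exp_neg]
  field_simp

/-- A measurable function dominated by a multiple of `e^{-t}` has finite moments of every order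
greater than `-1` on `(0, ∞)`. -/
theorem integrableOn_rpow_mul_of_le_exp_neg {b C : ℝ} (hb : -1 < b) {f : ℝ → ℝ}
    (hf : Measurable f) (hf0 : ∀ t, 0 ≤ f t) (hfC : ∀ t, f t ≤ C * Real.exp (-t)) :
    IntegrableOn (fun t => t ^ b * f t) (Set.Ioi 0) := by
  have hG := (Real.GammaIntegral_convergent (s := b + 1) (by linarith)).const_mul C
  refine hG.mono' (by fun_prop) ((ae_restrict_iff' measurableSet_Ioi).2 (ae_of_all _ ?_))
  intro t (ht : 0 < t)
  have htb := Real.rpow_nonneg ht.le b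
  rw [Real.norm_of_nonneg (mul_nonneg htb (hf0 t)), add_sub_cancel_right, ← mul_assoc, mul_comm]
  exact mul_le_mul_of_nonneg_right (hfC t) htb

theorem integral_rpow_mul_log_one_add_exp_sub {a : ℝ} (ha : -1 < a) (w : ℝ) :
    ∫ t in Set.Ioi (0 : ℝ), t ^ a * Real.log (1 + Real.exp (w - t)) =
      1 / (a + 1) * ∫ t in Set.Ioi (0 : ℝ), t ^ (a + 1) / (Real.exp (t - w) + 1) := by
  have ha1 : 0 < a + 1 := by linarith
  have hint : IntegrableOn (fun t => t ^ a * Real.log (1 + Real.exp (w - t))) (Set.Ioi 0) :=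
    integrableOn_rpow_mul_of_le_exp_neg ha (by fun_prop) (fun t => log_one_add_exp_nonneg _)
      (log_one_add_exp_sub_le w)
  have hint' : IntegrableOn (fun t => t ^ (a + 1) * (Real.exp (t - w) + 1)⁻¹) (Set.Ioi 0) :=
    integrableOn_rpow_mul_of_le_exp_neg (by linarith) (by fun_prop) (fun t => by positivity)
      (inv_exp_sub_add_one_le w)
  have hlim0 : Filter.Tendsto
      ((fun t => Real.log (1 + Real.exp (w - t))) * fun t => t ^ (a + 1) / (a + 1))
      (nhdsWithin 0 (Set.Ioi 0)) (nhds 0) := by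
    have hc : ContinuousAt
        ((fun t => Real.log (1 + Real.exp (w - t))) * fun t : ℝ => t ^ (a + 1) / (a + 1)) 0 :=
      (hasDerivAt_log_one_add_exp_sub w 0).continuousAt.mul
        ((Real.continuousAt_rpow_const 0 (a + 1) (Or.inr ha1.le)).div_const _)
    have h := hc.tendsto.mono_left (nhdsWithin_le_nhds (s := Set.Ioi 0))
    simpa [Real.zero_rpow ha1.ne'] using h
  have hlim : Filter.Tendsto
      ((fun t => Real.log (1 + Real.exp (w - t))) * fun t => t ^ (a + 1) / (a + 1))
      Filter.atTop (nhds 0) := by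
    have h := (tendsto_rpow_mul_exp_neg_mul_atTop_nhds_zero (a + 1) 1 one_pos).const_mul
      (Real.exp w / (a + 1))
    rw [mul_zero] at h
    refine squeeze_zero' ?_ ?_ h
    · filter_upwards [Filter.eventually_ge_atTop 0] with t ht
      exact mul_nonneg (log_one_add_exp_nonneg _) (by positivity)
    · filter_upwards [Filter.eventually_ge_atTop 0] with t ht
      calc _ ≤ Real.exp w * Real.exp (-t) * (t ^ (a + 1) / (a + 1)) :=
            mul_le_mul_of_nonneg_right (log_one_add_exp_sub_le w t) (by positivity)
        _ = _ := by rw [neg_one_mul]; ring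
  have hparts := integral_Ioi_mul_deriv_eq_deriv_mul
    (u := fun t => Real.log (1 + Real.exp (w - t))) (u' := fun t => -(Real.exp (t - w) + 1)⁻¹)
    (v := fun t => t ^ (a + 1) / (a + 1)) (v' := fun t => t ^ a)
    (fun t _ => hasDerivAt_log_one_add_exp_sub w t)
    (fun t (ht : 0 < t) => by
      convert (Real.hasDerivAt_rpow_const (p := a + 1) (Or.inl ht.ne')).div_const (a + 1) using 1
      rw [add_sub_cancel_right]
      field_simp)
    (hint.congr_fun (fun t _ => mul_comm _ _) measurableSet_Ioi)
    (IntegrableOn.congr_fun (hint'.const_mul (-(a + 1)⁻¹))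
      (fun t _ => by simp only [Pi.mul_apply]; ring) measurableSet_Ioi)
    hlim0 hlim
  simp_rw [mul_comm _ (Real.log _)]
  rw [hparts, sub_self, zero_sub, ← integral_neg, ← integral_const_mul]
  congr 1 with t
  ring

theorem softplus_moment_integral (a u : ℝ) (ha : -1 < a) (hu : 0 < u) :
    (∫ s in Set.Ioi (0 : ℝ), s ^ a * Real.log (1 + Real.exp (u * (1 - s))))
      = 1 / ((a + 1) * u ^ (a + 1)) *
          ∫ t in Set.Ioi (0 : ℝ), t ^ (a + 1) / (Real.exp (t - u) + 1) ∧
    (∫ s in Set.Ioi (0 : ℝ), s ^ a * Real.log (1 + Real.exp (u * (1 - s))))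
      = -(Real.Gamma (a + 1) / u ^ (a + 1)) * LiNegExp (a + 2) u := by
  have hscale : ∫ s in Set.Ioi (0 : ℝ), s ^ a * Real.log (1 + Real.exp (u * (1 - s))) =
      1 / ((a + 1) * u ^ (a + 1)) *
        ∫ t in Set.Ioi (0 : ℝ), t ^ (a + 1) / (Real.exp (t - u) + 1) := by
    have hcomp := integral_comp_mul_left_Ioi
      (fun t => t ^ a * Real.log (1 + Real.exp (u - t))) 0 hu
    rw [mul_zero, integral_rpow_mul_log_one_add_exp_sub ha, smul_eq_mul] at hcomp
    calc _ = ∫ s in Set.Ioi (0 : ℝ),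
          (u ^ a)⁻¹ * ((u * s) ^ a * Real.log (1 + Real.exp (u - u * s))) := by
          refine setIntegral_congr_fun measurableSet_Ioi fun s (hs : 0 < s) => ?_
          have := (Real.rpow_pos_of_pos hu a).ne'
          simp only [Real.mul_rpow hu.le hs.le, mul_sub, mul_one]
          field_simp
      _ = _ := by
          rw [integral_const_mul, hcomp, Real.rpow_add_one hu.ne']
          field_simp
  refine ⟨hscale, ?_⟩
  have ha1 : 0 < a + 1 := by linarith
  have hΓ : Real.Gamma (a + 2) = (a + 1) * Real.Gamma (a + 1) := by
    rw [← Real.Gamma_add_one ha1.ne', add_assoc, one_add_one_eq_two]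
  have hΓ0 := (Real.Gamma_pos_of_pos ha1).ne'
  rw [hscale, LiNegExp, hΓ, show a + 2 - 1 = a + 1 by ring]
  field_simp
end
end

section
/- Let r ≥ 1 and h > 0, and define the reciprocal normalizing constant of the spherically symmetric Epanechnikov kernel on (S²)^r with equal bandwidth by c^{-1}(h) := (2π)^r ∫_{[−1,1]^r} max(0, 1 − Σ_{j=1}^r (1−t_j)/h²) dt. Then c^{-1}(h) = ((2πh²)^r (−1)^r/(r+1)!) · Σ_{ℓ=⌈r−h²/2⌉}^{r} C(r,ℓ)(−1)^ℓ (1 − 2h^{−2}(r−ℓ))^{r+1}, where C(r,ℓ) is the binomial coefficient and the sum is over integers ℓ with max(0, ⌈r−h²/2⌉) ≤ ℓ ≤ r. In particular, if h < √2 then c^{-1}(h) = (2πh²)^r/(r+1)!. -/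
/-!
Proposition 6 (Epanechnikov part): normalizing constant of the spherically
symmetric Epanechnikov kernel on `(S²)^r` with equal bandwidth.
-/

open MeasureTheory Set

noncomputable section

theorem hasDerivWithinAt_max_zero_pow (p : ℕ) (x : ℝ) :
    HasDerivWithinAt (fun y : ℝ => max 0 y ^ (p + 2)) (((p : ℝ) + 2) * max 0 x ^ (p + 1))
      (Ioi x) x := by
  rcases lt_or_ge x 0 with hx | hx
  · have h0 : HasDerivAt (fun y : ℝ => max 0 y ^ (p + 2)) 0 x := by
      refine (hasDerivAt_const x (0 : ℝ)).congr_of_eventuallyEq ?_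
      filter_upwards [Iio_mem_nhds hx] with y hy
      rw [max_eq_left (le_of_lt hy)]
      simp
    rw [max_eq_left hx.le]
    simpa using h0.hasDerivWithinAt
  · have h1 : HasDerivAt (fun y : ℝ => y ^ (p + 2)) (((p : ℝ) + 2) * x ^ (p + 1)) x := by
      simpa using hasDerivAt_pow (p + 2) x
    rw [max_eq_right hx]
    refine h1.hasDerivWithinAt.congr (fun y hy => ?_) ?_
    · rw [max_eq_right (hx.trans (le_of_lt hy))]
    · rw [max_eq_right hx]

theorem integral_max_zero_pow (p : ℕ) {a b : ℝ} (hab : a ≤ b) :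
    ∫ x in a..b, max 0 x ^ (p + 1) = (max 0 b ^ (p + 2) - max 0 a ^ (p + 2)) / ((p : ℝ) + 2) := by
  have hp : (p : ℝ) + 2 ≠ 0 := by positivity
  have key := intervalIntegral.integral_eq_sub_of_hasDeriv_right_of_le
    (f := fun y : ℝ => max 0 y ^ (p + 2)) (f' := fun x => ((p : ℝ) + 2) * max 0 x ^ (p + 1)) hab
    (by fun_prop) (fun x _ => hasDerivWithinAt_max_zero_pow p x)
    (Continuous.intervalIntegrable (by fun_prop) _ _)
  rw [intervalIntegral.integral_const_mul] at key
  rw [eq_div_iff hp, mul_comm, key]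

theorem integral_Icc_max_zero_pow (p : ℕ) {c : ℝ} (hc : 0 < c) (b : ℝ) :
    ∫ t in Icc (-1 : ℝ) 1, max 0 (b - (1 - t) / c) ^ (p + 1)
      = c / ((p : ℝ) + 2) * (max 0 b ^ (p + 2) - max 0 (b - 2 / c) ^ (p + 2)) := by
  rw [integral_Icc_eq_integral_Ioc, ← intervalIntegral.integral_of_le (by norm_num)]
  have hfun : ∀ t : ℝ, max 0 (b - (1 - t) / c) ^ (p + 1)
      = (fun x : ℝ => max 0 x ^ (p + 1)) (t / c + (b - 1 / c)) := by
    intro t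
    simp only
    congr 2
    ring
  rw [intervalIntegral.integral_congr fun t _ => hfun t,
    intervalIntegral.integral_comp_div_add (fun x : ℝ => max 0 x ^ (p + 1)) hc.ne',
    integral_max_zero_pow]
  · rw [smul_eq_mul, show (1 : ℝ) / c + (b - 1 / c) = b by ring,
      show (-1 : ℝ) / c + (b - 1 / c) = b - 2 / c by ring]
    ring
  · gcongr
    norm_num

theorem sum_range_choose_mul_sub_succ (n : ℕ) (g : ℕ → ℝ) :
    ∑ k ∈ Finset.range (n + 1), (n.choose k : ℝ) * (-1) ^ k * (g k - g (k + 1))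
      = ∑ k ∈ Finset.range (n + 2), ((n + 1).choose k : ℝ) * (-1) ^ k * g k := by
  rw [Finset.sum_range_succ' _ (n + 1)]
  simp_rw [mul_sub, Finset.sum_sub_distrib, Nat.choose_succ_succ, Nat.cast_add, add_mul,
    Finset.sum_add_distrib]
  rw [Finset.sum_range_succ' _ n, Finset.sum_range_succ (fun k => (n.choose (k + 1) : ℝ) * _ * _) n]
  simp [pow_succ]
  ring

theorem integral_pi_Icc_max_zero {c : ℝ} (hc : 0 < c) (n : ℕ) (a : ℝ) :
    ∫ t in univ.pi fun _ : Fin n => Icc (-1 : ℝ) 1, max 0 (a - ∑ j, (1 - t j) / c)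
      = c ^ n / (n + 1).factorial *
        ∑ k ∈ Finset.range (n + 1),
          (n.choose k : ℝ) * (-1) ^ k * max 0 (a - 2 / c * k) ^ (n + 1) := by
  induction n generalizing a with
  | zero =>
    rw [volume_pi, Measure.restrict_pi_pi, Measure.pi_of_empty]
    simp
  | succ n ih =>
    have hint : Integrable (fun t : Fin (n + 1) → ℝ => max 0 (a - ∑ j, (1 - t j) / c))
        (Measure.pi fun _ => volume.restrict (Icc (-1 : ℝ) 1)) := by
      rw [← Measure.restrict_pi_pi]
      exact ContinuousOn.integrableOn_compact (isCompact_univ_pi fun _ => isCompact_Icc)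
        (by fun_prop)
    have hmp := (measurePreserving_piFinSuccAbove
      (fun _ : Fin (n + 1) => (volume : Measure ℝ).restrict (Icc (-1 : ℝ) 1)) 0).symm
    rw [volume_pi, Measure.restrict_pi_pi, ← hmp.integral_comp', integral_prod]
    · have inner : ∀ x : ℝ, (∫ y, max 0 (a - ∑ j, (1 - (MeasurableEquiv.piFinSuccAbove
            (fun _ : Fin (n + 1) => ℝ) 0).symm (x, y) j) / c)
            ∂Measure.pi fun _ : Fin n => (volume : Measure ℝ).restrict (Icc (-1 : ℝ) 1))
          = c ^ n / (n + 1).factorial * ∑ k ∈ Finset.range (n + 1),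
            (n.choose k : ℝ) * (-1) ^ k *
              max 0 ((a - 2 / c * k) - (1 - x) / c) ^ (n + 1) := by
        intro x
        rw [← Measure.restrict_pi_pi, ← volume_pi]
        simp_rw [sub_right_comm a _ ((1 - x) / c)]
        rw [← ih (a - (1 - x) / c)]
        refine integral_congr_ae (Filter.Eventually.of_forall fun y => ?_)
        simp [MeasurableEquiv.piFinSuccAbove, Fin.sum_univ_succ, sub_sub]
      refine (integral_congr_ae (Filter.Eventually.of_forall inner)).trans ?_
      rw [integral_const_mul, integral_finsetSum]
      · simp_rw [integral_const_mul, integral_Icc_max_zero_pow n hc]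
        rw [← sum_range_choose_mul_sub_succ n (fun k => max 0 (a - 2 / c * k) ^ (n + 2)),
          Finset.mul_sum, Finset.mul_sum]
        refine Finset.sum_congr rfl fun k _ => ?_
        have hk : a - 2 / c * ((k + 1 : ℕ) : ℝ) = a - 2 / c * k - 2 / c := by
          push_cast
          ring
        have hfac : ((n + 1 + 1).factorial : ℝ) = ((n : ℝ) + 2) * (n + 1).factorial := by
          rw [Nat.factorial_succ]
          push_cast
          ring
        have hn : (n : ℝ) + 2 ≠ 0 := by positivity
        have hf : ((n + 1).factorial : ℝ) ≠ 0 := by positivity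
        rw [hk, hfac]
        field_simp
        ring
      · intro k _
        exact ContinuousOn.integrableOn_compact isCompact_Icc (by fun_prop)
    · exact hmp.integrable_comp_of_integrable hint

theorem sum_Icc_ceil_choose_mul_pow {c : ℝ} (hc : 0 < c) (r : ℕ) :
    ∑ k ∈ Finset.range (r + 1), (r.choose k : ℝ) * (-1) ^ k * max 0 (1 - 2 / c * k) ^ (r + 1)
      = (-1) ^ r * ∑ l ∈ Finset.Icc (⌈(r : ℝ) - c / 2⌉.toNat) r,
          (r.choose l : ℝ) * (-1) ^ l * (1 - 2 / c * ((r : ℝ) - l)) ^ (r + 1) := by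
  have hrw : ∀ l : ℕ, 1 - 2 / c * ((r : ℝ) - l) = 2 / c * (l - ((r : ℝ) - c / 2)) := by
    intro l
    field_simp
    ring
  have hmem : ∀ l : ℕ, ⌈(r : ℝ) - c / 2⌉.toNat ≤ l ↔ (r : ℝ) - c / 2 ≤ l := by
    intro l
    rw [Int.toNat_le, Int.ceil_le]
    simp
  rw [← Finset.sum_range_reflect, Finset.mul_sum]
  symm
  have hsub : Finset.Icc (⌈(r : ℝ) - c / 2⌉.toNat) r ⊆ Finset.range (r + 1) := by
    intro l hl
    rw [Finset.mem_Icc] at hl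
    exact Finset.mem_range.2 (Nat.lt_succ_of_le hl.2)
  refine Finset.sum_subset_zero_on_sdiff hsub (fun l hl => ?_) (fun l hl => ?_)
  · rw [Finset.mem_sdiff, Finset.mem_range, Finset.mem_Icc] at hl
    have hlr : l ≤ r := by omega
    have hlt : (l : ℝ) < (r : ℝ) - c / 2 := by
      by_contra! hle
      exact hl.2 ⟨(hmem l).2 hle, hlr⟩
    have hneg : 1 - 2 / c * ((r : ℝ) - l) ≤ 0 := by
      rw [hrw]
      exact mul_nonpos_of_nonneg_of_nonpos (by positivity) (by linarith)
    rw [show r + 1 - 1 - l = r - l by omega, Nat.cast_sub hlr, max_eq_left hneg]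
    simp
  · rw [Finset.mem_Icc] at hl
    have hpos : 0 ≤ 1 - 2 / c * ((r : ℝ) - l) := by
      rw [hrw]
      exact mul_nonneg (by positivity) (sub_nonneg.2 ((hmem l).1 hl.1))
    have hsign : (-1 : ℝ) ^ (r - l) = (-1) ^ r * (-1) ^ l := by
      obtain ⟨k, rfl⟩ := Nat.exists_eq_add_of_le hl.2
      rw [Nat.add_sub_cancel_left, pow_add, mul_right_comm, ← mul_pow]
      simp
    rw [show r + 1 - 1 - l = r - l by omega, Nat.cast_sub hl.2, max_eq_right hpos,
      Nat.choose_symm hl.2, hsign]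
    ring

theorem spherically_symmetric_epanechnikov_normalizing_constant_sphere2
    (r : ℕ) (hr : 1 ≤ r) (h : ℝ) (hh : 0 < h) :
    (2 * Real.pi) ^ r *
        (∫ t in Set.univ.pi fun _ : Fin r => Icc (-1 : ℝ) 1,
          max 0 (1 - ∑ j, (1 - t j) / h ^ 2))
      = (2 * Real.pi * h ^ 2) ^ r * (-1 : ℝ) ^ r / (Nat.factorial (r + 1)) *
          ∑ l ∈ Finset.Icc (⌈(r : ℝ) - h ^ 2 / 2⌉.toNat) r,
            (r.choose l : ℝ) * (-1 : ℝ) ^ l *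
              (1 - 2 / h ^ 2 * ((r : ℝ) - (l : ℝ))) ^ (r + 1) ∧
    (h < Real.sqrt 2 →
      (2 * Real.pi) ^ r *
          (∫ t in Set.univ.pi fun _ : Fin r => Icc (-1 : ℝ) 1,
            max 0 (1 - ∑ j, (1 - t j) / h ^ 2))
        = (2 * Real.pi * h ^ 2) ^ r / (Nat.factorial (r + 1))) := by
  have hc : 0 < h ^ 2 := by positivity
  have hmain : (2 * Real.pi) ^ r *
        (∫ t in Set.univ.pi fun _ : Fin r => Icc (-1 : ℝ) 1,
          max 0 (1 - ∑ j, (1 - t j) / h ^ 2))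
      = (2 * Real.pi * h ^ 2) ^ r * (-1 : ℝ) ^ r / (Nat.factorial (r + 1)) *
          ∑ l ∈ Finset.Icc (⌈(r : ℝ) - h ^ 2 / 2⌉.toNat) r,
            (r.choose l : ℝ) * (-1 : ℝ) ^ l *
              (1 - 2 / h ^ 2 * ((r : ℝ) - (l : ℝ))) ^ (r + 1) := by
    rw [integral_pi_Icc_max_zero hc, sum_Icc_ceil_choose_mul_pow hc, mul_pow (2 * Real.pi)]
    ring
  refine ⟨hmain, fun hlt => ?_⟩
  have hlt2 : h ^ 2 < 2 := (Real.lt_sqrt hh.le).1 hlt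
  have hceil : ⌈(r : ℝ) - h ^ 2 / 2⌉ = (r : ℤ) := by
    rw [Int.ceil_eq_iff]
    push_cast
    constructor <;> linarith
  rw [hmain, hceil, Int.toNat_natCast, Finset.Icc_self, Finset.sum_singleton]
  have hsign : (-1 : ℝ) ^ r * (-1) ^ r = 1 := by
    rw [← mul_pow]
    simp
  simp only [Nat.choose_self, sub_self, mul_zero, sub_zero, one_pow, mul_one, Nat.cast_one, one_mul]
  rw [div_mul_eq_mul_div, mul_assoc, hsign, mul_one]
end
end

section
/- Let r, d ≥ 1 be integers. Define for a one-dimensional kernel L the moment constants b_m(L) := ∫_0^∞ L(t)t^{m/2} dt/(m∫_0^∞ L(t)t^{m/2−1} dt) and v_m(L) := ∫_0^∞ L(t)²t^{m/2−1} dt/(2^{m/2−1}ω_{m−1}(∫_0^∞ L(t)t^{m/2−1} dt)²) with ω_{m−1} := 2π^{m/2}/Γ(m/2), and the AMISE constants C^S(L) := [v_{dr}(L)⁴ · b_{dr}(L)^{2dr}]^{1/(dr+4)} (spherically symmetric version) and C^P(L) := [v_d(L)^{4r} · b_d(L)^{2dr}]^{1/(dr+4)} (product version). Then the efficiencies relative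 to the spherically symmetric Epanechnikov kernel satisfy: (i) eff_{d,r}(L_vMF^S) := [C^S(L_Epa)/C^S(L_vMF)]^{(dr+4)/4} = 2^{dr+2} Γ(dr/2+2)/(dr+4)^{dr/2+1}; (ii) eff_{d,r}(L_Epa^P) := [C^S(L_Epa)/C^P(L_Epa)]^{(dr+4)/4} = 4^{1−r} Γ(dr/2+2)(d+4)^{r(d/2+1)} / ( Γ(d/2+2)^r (dr+4)^{dr/2+1} ). -/
/-!
Proposition 7 (kernel efficiencies of the spherically symmetric vMF kernel and
the product Epanechnikov kernel relative to the spherically symmetric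
Epanechnikov kernel on `(S^d)^r`).
-/

open MeasureTheory

noncomputable section

/-- Surface area of `S^{m-1} ⊆ ℝ^m`: `ω_{m-1} = 2π^{m/2}/Γ(m/2)`. -/
def omegaPred (m : ℝ) : ℝ := 2 * Real.pi ^ (m / 2) / Real.Gamma (m / 2)

/-- First kernel moment constant `b_m(L)`. -/
def bMoment (m : ℕ) (L : ℝ → ℝ) : ℝ :=
  (∫ t in Set.Ioi (0 : ℝ), L t * t ^ ((m : ℝ) / 2)) /
    ((m : ℝ) * ∫ t in Set.Ioi (0 : ℝ), L t * t ^ ((m : ℝ) / 2 - 1))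

/-- Second kernel moment constant `v_m(L)`. -/
def vMoment (m : ℕ) (L : ℝ → ℝ) : ℝ :=
  (∫ t in Set.Ioi (0 : ℝ), (L t) ^ 2 * t ^ ((m : ℝ) / 2 - 1)) /
    ((2 : ℝ) ^ ((m : ℝ) / 2 - 1) * omegaPred (m : ℝ) *
      (∫ t in Set.Ioi (0 : ℝ), L t * t ^ ((m : ℝ) / 2 - 1)) ^ 2)

/-- AMISE constant of the spherically symmetric version of `L` on `(S^d)^r`. -/
def CS (d r : ℕ) (L : ℝ → ℝ) : ℝ :=
  (vMoment (d * r) L ^ 4 * bMoment (d * r) L ^ (2 * (d * r))) ^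
    ((1 : ℝ) / ((d * r : ℕ) + 4))

/-- AMISE constant of the product version of `L` on `(S^d)^r`. -/
def CP (d r : ℕ) (L : ℝ → ℝ) : ℝ :=
  (vMoment d L ^ (4 * r) * bMoment d L ^ (2 * (d * r))) ^
    ((1 : ℝ) / ((d * r : ℕ) + 4))

/-- The von Mises–Fisher kernel. -/
def vMFKernel (t : ℝ) : ℝ := Real.exp (-t)

/-- The Epanechnikov kernel. -/
def epaKernel (t : ℝ) : ℝ := if 0 ≤ t ∧ t ≤ 1 then 1 - t else 0

lemma integral_Ioi_eq_intervalIntegral_of_eq_on {F G : ℝ → ℝ}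
    (h : ∀ t ∈ Set.Ioc (0 : ℝ) 1, F t = G t) (h0 : ∀ t, 1 < t → F t = 0) :
    ∫ t in Set.Ioi (0 : ℝ), F t = ∫ t in (0 : ℝ)..1, G t := by
  rw [intervalIntegral.integral_of_le zero_le_one,
    ← setIntegral_congr_fun measurableSet_Ioc h]
  refine setIntegral_eq_of_subset_of_forall_sdiff_eq_zero measurableSet_Ioi
    Set.Ioc_subset_Ioi_self fun t ht => h0 t ?_
  by_contra hle
  exact ht.2 ⟨ht.1, not_lt.mp hle⟩

lemma integral_epaKernel_mul_rpow {s : ℝ} (hs : -1 < s) :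
    ∫ t in Set.Ioi (0 : ℝ), epaKernel t * t ^ s = 1 / ((s + 1) * (s + 2)) := by
  rw [integral_Ioi_eq_intervalIntegral_of_eq_on (G := fun t => t ^ s - t ^ (s + 1))]
  · rw [intervalIntegral.integral_sub (intervalIntegral.intervalIntegrable_rpow' hs)
      (intervalIntegral.intervalIntegrable_rpow' (by linarith)),
      integral_rpow (Or.inl hs), integral_rpow (Or.inl (by linarith))]
    have h1 : s + 1 ≠ 0 := by linarith
    have h2 : s + 2 ≠ 0 := by linarith
    have h3 : s + 1 + 1 = s + 2 := by ring
    rw [h3, Real.one_rpow, Real.one_rpow, Real.zero_rpow h1, Real.zero_rpow h2]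
    field_simp
    ring
  · intro t ht
    simp only [epaKernel, if_pos (And.intro ht.1.le ht.2), Real.rpow_add_one ht.1.ne']
    ring
  · intro t ht
    simp [epaKernel, ht]

lemma integral_epaKernel_sq_mul_rpow {s : ℝ} (hs : -1 < s) :
    ∫ t in Set.Ioi (0 : ℝ), epaKernel t ^ 2 * t ^ s
      = 2 / ((s + 1) * (s + 2) * (s + 3)) := by
  have hint {a : ℝ} (ha : -1 < a) : IntervalIntegrable (fun t : ℝ => t ^ a) volume 0 1 :=
    intervalIntegral.intervalIntegrable_rpow' ha
  rw [integral_Ioi_eq_intervalIntegral_of_eq_on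
    (G := fun t => t ^ s - 2 * t ^ (s + 1) + t ^ (s + 1 + 1))]
  · rw [intervalIntegral.integral_add
        ((hint hs).sub ((hint (by linarith)).const_mul 2)) (hint (by linarith)),
      intervalIntegral.integral_sub (hint hs) ((hint (by linarith)).const_mul 2),
      intervalIntegral.integral_const_mul,
      integral_rpow (Or.inl hs), integral_rpow (Or.inl (by linarith)),
      integral_rpow (Or.inl (by linarith))]
    have h1 : s + 1 ≠ 0 := by linarith
    have h2 : s + 2 ≠ 0 := by linarith
    have h3 : s + 3 ≠ 0 := by linarith
    have h4 : s + 1 + 1 = s + 2 := by ring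
    have h5 : s + 2 + 1 = s + 3 := by ring
    rw [h4, h5, Real.one_rpow, Real.one_rpow, Real.one_rpow, Real.zero_rpow h1,
      Real.zero_rpow h2, Real.zero_rpow h3]
    field_simp
    ring
  · intro t ht
    simp only [epaKernel, if_pos (And.intro ht.1.le ht.2),
      Real.rpow_add_one ht.1.ne']
    ring
  · intro t ht
    simp [epaKernel, ht]

lemma integral_vMFKernel_mul_rpow {s : ℝ} (hs : -1 < s) :
    ∫ t in Set.Ioi (0 : ℝ), vMFKernel t * t ^ s = Real.Gamma (s + 1) := by
  rw [Real.Gamma_eq_integral (by linarith)]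
  simp [vMFKernel]

lemma integral_vMFKernel_sq_mul_rpow {s : ℝ} (hs : -1 < s) :
    ∫ t in Set.Ioi (0 : ℝ), vMFKernel t ^ 2 * t ^ s
      = Real.Gamma (s + 1) / 2 ^ (s + 1) := by
  have h := Real.integral_rpow_mul_exp_neg_mul_Ioi (a := s + 1) (r := 2) (by linarith) two_pos
  rw [add_sub_cancel_right] at h
  rw [div_eq_inv_mul, ← Real.inv_rpow two_pos.le, ← one_div, ← h]
  refine integral_congr_ae (.of_forall fun t => ?_)
  simp only [vMFKernel, ← Real.exp_nat_mul]
  rw [mul_comm]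
  norm_num

lemma cast_half_pos {m : ℕ} (hm : 1 ≤ m) : (0 : ℝ) < m / 2 := by
  have : (1 : ℝ) ≤ m := by exact_mod_cast hm
  linarith

lemma bMoment_epaKernel {m : ℕ} (hm : 1 ≤ m) : bMoment m epaKernel = 1 / ((m : ℝ) + 4) := by
  have hn := cast_half_pos hm
  rw [bMoment, integral_epaKernel_mul_rpow (by linarith),
    integral_epaKernel_mul_rpow (by linarith)]
  have : (m : ℝ) = 2 * (m / 2) := by ring
  generalize (m : ℝ) / 2 = n at *
  rw [this, show n - 1 + 1 = n by ring, show n - 1 + 2 = n + 1 by ring]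
  field_simp
  ring

lemma vMoment_epaKernel {m : ℕ} (hm : 1 ≤ m) :
    vMoment m epaKernel = 4 * Real.Gamma ((m : ℝ) / 2 + 2) /
      (((m : ℝ) + 4) * (2 * Real.pi) ^ ((m : ℝ) / 2)) := by
  have hn := cast_half_pos hm
  rw [vMoment, omegaPred, integral_epaKernel_mul_rpow (by linarith),
    integral_epaKernel_sq_mul_rpow (by linarith)]
  have : (m : ℝ) = 2 * (m / 2) := by ring
  generalize (m : ℝ) / 2 = n at *
  have hG := Real.Gamma_pos_of_pos hn
  have hpi := Real.rpow_pos_of_pos Real.pi_pos n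
  have h2 := Real.rpow_pos_of_pos (two_pos (α := ℝ)) n
  rw [this, show n - 1 + 1 = n by ring, show n - 1 + 2 = n + 1 by ring,
    show n - 1 + 3 = n + 2 by ring, show n + 2 = n + 1 + 1 by ring,
    Real.Gamma_add_one (by linarith), Real.Gamma_add_one hn.ne',
    Real.mul_rpow two_pos.le Real.pi_pos.le, Real.rpow_sub_one two_ne_zero]
  field_simp
  ring

lemma bMoment_vMFKernel {m : ℕ} (hm : 1 ≤ m) : bMoment m vMFKernel = 1 / 2 := by
  have hn := cast_half_pos hm
  rw [bMoment, integral_vMFKernel_mul_rpow (by linarith),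
    integral_vMFKernel_mul_rpow (by linarith)]
  have : (m : ℝ) = 2 * (m / 2) := by ring
  generalize (m : ℝ) / 2 = n at *
  have hG := Real.Gamma_pos_of_pos hn
  rw [this, sub_add_cancel, Real.Gamma_add_one hn.ne']
  field_simp

lemma vMoment_vMFKernel {m : ℕ} (hm : 1 ≤ m) :
    vMoment m vMFKernel = 1 / (4 * Real.pi) ^ ((m : ℝ) / 2) := by
  have hn := cast_half_pos hm
  rw [vMoment, omegaPred, integral_vMFKernel_mul_rpow (by linarith),
    integral_vMFKernel_sq_mul_rpow (by linarith)]
  generalize (m : ℝ) / 2 = n at *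
  have hG := Real.Gamma_pos_of_pos hn
  have hpi := Real.rpow_pos_of_pos Real.pi_pos n
  have h2 := Real.rpow_pos_of_pos (two_pos (α := ℝ)) n
  rw [sub_add_cancel, Real.mul_rpow (by norm_num) Real.pi_pos.le,
    Real.rpow_sub_one two_ne_zero, show (4 : ℝ) = 2 * 2 by norm_num,
    Real.mul_rpow two_pos.le two_pos.le]
  field_simp

lemma rpow_amise_exponent {v b : ℝ} (hv : 0 ≤ v) (hb : 0 ≤ b) (M : ℕ) :
    ((v ^ 4 * b ^ (2 * M)) ^ ((1 : ℝ) / ((M : ℝ) + 4))) ^ (((M : ℝ) + 4) / 4)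
      = v * b ^ ((M : ℝ) / 2) := by
  have hM : (M : ℝ) + 4 ≠ 0 := by positivity
  rw [← Real.rpow_mul (by positivity),
    show (1 : ℝ) / ((M : ℝ) + 4) * (((M : ℝ) + 4) / 4) = 1 / 4 by field_simp,
    Real.mul_rpow (by positivity) (by positivity), ← Real.rpow_natCast v,
    ← Real.rpow_natCast b, ← Real.rpow_mul hv, ← Real.rpow_mul hb]
  congr 1
  · norm_num
  · congr 1
    push_cast
    ring

lemma CS_rpow (d r : ℕ) {L : ℝ → ℝ} (hv : 0 ≤ vMoment (d * r) L)
    (hb : 0 ≤ bMoment (d * r) L) :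
    CS d r L ^ (((d * r : ℕ) + 4 : ℝ) / 4)
      = vMoment (d * r) L * bMoment (d * r) L ^ (((d * r : ℕ) : ℝ) / 2) :=
  rpow_amise_exponent hv hb _

lemma CP_rpow (d r : ℕ) {L : ℝ → ℝ} (hv : 0 ≤ vMoment d L) (hb : 0 ≤ bMoment d L) :
    CP d r L ^ (((d * r : ℕ) + 4 : ℝ) / 4)
      = vMoment d L ^ r * bMoment d L ^ (((d * r : ℕ) : ℝ) / 2) := by
  rw [CP, mul_comm 4 r, pow_mul]
  exact rpow_amise_exponent (pow_nonneg hv r) hb _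

lemma bMoment_epaKernel_pos {m : ℕ} (hm : 1 ≤ m) : 0 < bMoment m epaKernel := by
  rw [bMoment_epaKernel hm]
  positivity

lemma vMoment_epaKernel_pos {m : ℕ} (hm : 1 ≤ m) : 0 < vMoment m epaKernel := by
  rw [vMoment_epaKernel hm]
  have := Real.Gamma_pos_of_pos (show (0 : ℝ) < m / 2 + 2 by positivity)
  positivity

theorem kernel_efficiencies (d r : ℕ) (hd : 1 ≤ d) (hr : 1 ≤ r) :
    (CS d r epaKernel / CS d r vMFKernel) ^ (((d * r : ℕ) + 4 : ℝ) / 4)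
      = 2 ^ (d * r + 2) * Real.Gamma (((d * r : ℕ) : ℝ) / 2 + 2) /
          (((d * r : ℕ) : ℝ) + 4) ^ (((d * r : ℕ) : ℝ) / 2 + 1) ∧
    (CS d r epaKernel / CP d r epaKernel) ^ (((d * r : ℕ) + 4 : ℝ) / 4)
      = (4 : ℝ) ^ ((1 : ℝ) - r) * Real.Gamma (((d * r : ℕ) : ℝ) / 2 + 2) *
          ((d : ℝ) + 4) ^ ((r : ℝ) * ((d : ℝ) / 2 + 1)) /
          (Real.Gamma ((d : ℝ) / 2 + 2) ^ r * (((d * r : ℕ) : ℝ) + 4) ^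
            (((d * r : ℕ) : ℝ) / 2 + 1)) := by
  have hm : 1 ≤ d * r := Nat.mul_pos hd hr
  have hCS := CS_rpow d r (vMoment_epaKernel_pos hm).le (bMoment_epaKernel_pos hm).le
  have hCS0 : 0 ≤ CS d r epaKernel := by
    have := vMoment_epaKernel_pos hm
    have := bMoment_epaKernel_pos hm
    unfold CS
    positivity
  have hG := Real.Gamma_pos_of_pos (show (0 : ℝ) < ((d * r : ℕ) : ℝ) / 2 + 2 by positivity)
  have hGd := Real.Gamma_pos_of_pos (show (0 : ℝ) < (d : ℝ) / 2 + 2 by positivity)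
  have hM : (0 : ℝ) < ((d * r : ℕ) : ℝ) + 4 := by positivity
  constructor
  · have hv : 0 < vMoment (d * r) vMFKernel := by
      rw [vMoment_vMFKernel hm]
      positivity
    have hb : 0 < bMoment (d * r) vMFKernel := by
      rw [bMoment_vMFKernel hm]
      positivity
    rw [Real.div_rpow hCS0 (by unfold CS; positivity), hCS, CS_rpow d r hv.le hb.le,
      vMoment_epaKernel hm, bMoment_epaKernel hm, vMoment_vMFKernel hm, bMoment_vMFKernel hm]
    have h2 : (2 : ℝ) ^ (d * r + 2) =
        4 * (2 ^ (((d * r : ℕ) : ℝ) / 2) * 2 ^ (((d * r : ℕ) : ℝ) / 2)) := by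
      rw [← Real.rpow_add two_pos, add_halves, Real.rpow_natCast, pow_add]
      ring
    rw [h2]
    generalize ((d * r : ℕ) : ℝ) = M at *
    rw [Real.rpow_add_one hM.ne', Real.div_rpow zero_le_one hM.le,
      Real.div_rpow zero_le_one two_pos.le, Real.one_rpow,
      Real.mul_rpow two_pos.le Real.pi_pos.le, show (4 : ℝ) * Real.pi = 2 * (2 * Real.pi) by ring,
      Real.mul_rpow two_pos.le (by positivity), Real.mul_rpow two_pos.le Real.pi_pos.le]
    field_simp
  · have hv := vMoment_epaKernel_pos hd
    have hb := bMoment_epaKernel_pos hd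
    rw [Real.div_rpow hCS0 (by unfold CP; positivity), hCS, CP_rpow d r hv.le hb.le,
      vMoment_epaKernel hm, bMoment_epaKernel hm, vMoment_epaKernel hd, bMoment_epaKernel hd]
    have hd4 : (0 : ℝ) < (d : ℝ) + 4 := by positivity
    have h2 : ((2 * Real.pi) ^ ((d : ℝ) / 2)) ^ r = (2 * Real.pi) ^ (((d * r : ℕ) : ℝ) / 2) := by
      rw [← Real.rpow_natCast, ← Real.rpow_mul (by positivity)]
      push_cast
      ring_nf
    have h3 : ((d : ℝ) + 4) ^ ((r : ℝ) * ((d : ℝ) / 2 + 1)) =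
        (d + 4) ^ (((d * r : ℕ) : ℝ) / 2) * (d + 4) ^ r := by
      rw [← Real.rpow_natCast _ r, ← Real.rpow_add hd4]
      push_cast
      ring_nf
    rw [h3, div_pow, mul_pow, mul_pow, h2, Real.rpow_sub (by norm_num), Real.rpow_one,
      Real.rpow_natCast]
    generalize ((d * r : ℕ) : ℝ) = M at *
    rw [Real.rpow_add_one hM.ne', Real.div_rpow zero_le_one hM.le,
      Real.div_rpow zero_le_one hd4.le, Real.one_rpow]
    field_simp
end
end
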